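/- For all real a > 0 and p > 0: ∫₀^{a} (x − p)²·max(√x, √p)/√(x·(a − x)) dx = (16/15)·(a − p)^{5/2} − (3/4)·p·(a − 2p)·√(a − p) + 2·√p·((3/8)·a² − a·p + p²)·arcsin √(p/a) if p < a, and = π·√p·((3/8)·a² − a·p + p²) if p ≥ a. -/

import Mathlib

open MeasureTheory Real

lemma ftc_aux (f F : ℝ → ℝ) (c d : ℝ) (h : c ≤ d) (hF : Continuous F)
    (hd : ∀ x ∈ Set.Ioo c d, HasDerivAt F (f x) x) (hn : ∀ x ∈ Set.Ioo c d, 0 ≤ f x) :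
    IntervalIntegrable f volume c d ∧ ∫ x in c..d, f x = F d - F c := by
  have hi : IntervalIntegrable f volume c d := by
    rw [intervalIntegrable_iff_integrableOn_Ioc_of_le h]
    exact intervalIntegral.integrableOn_deriv_of_nonneg hF.continuousOn hd hn
  exact ⟨hi, intervalIntegral.integral_eq_sub_of_hasDerivAt_of_le h hF.continuousOn hd hi⟩

noncomputable def F1 (a p x : ℝ) : ℝ :=
  √p * (2 * ((3/8)*a^2 - a*p + p^2) * arcsin (√x / √a)
    + √x * √(a - x) * (-(3/4)*a - x/2 + 2*p))

noncomputable def F2 (a p x : ℝ) : ℝ :=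
  -2 * ((a-p)^2 * √(a-x) - 2*(a-p)*√(a-x)^3/3 + √(a-x)^5/5)

lemma F1_cont (a p : ℝ) : Continuous (F1 a p) := by
  unfold F1
  have := Real.continuous_arcsin
  fun_prop

lemma F2_cont (a p : ℝ) : Continuous (F2 a p) := by
  unfold F2
  fun_prop

lemma F1_deriv (a p x : ℝ) (hx : 0 < x) (hxa : x < a) (hxp : x ≤ p) :
    HasDerivAt (F1 a p) ((x - p)^2 * max (√x) (√p) / √(x*(a - x))) x := by
  have ha : 0 < a := hx.trans hxa
  rw [max_eq_right (Real.sqrt_le_sqrt hxp), Real.sqrt_mul hx.le]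
  have hs : 0 < √x := Real.sqrt_pos.2 hx
  have ht : 0 < √(a-x) := Real.sqrt_pos.2 (by linarith)
  have hr : 0 < √a := Real.sqrt_pos.2 ha
  have es : √x^2 = x := Real.sq_sqrt hx.le
  have et : √(a-x)^2 = a-x := Real.sq_sqrt (by linarith)
  have er : √a^2 = a := Real.sq_sqrt ha.le
  have d1 : HasDerivAt (fun y => √y) (1/(2*√x)) x := Real.hasDerivAt_sqrt hx.ne'
  have d2 : HasDerivAt (fun y => √(a-y)) (-1/(2*√(a-x))) x :=
    ((hasDerivAt_id x).const_sub a).sqrt (by simp; linarith)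
  have lt1 : √x / √a < 1 := by
    rw [div_lt_one hr]; exact Real.sqrt_lt_sqrt hx.le hxa
  have pos1 : 0 < √x / √a := by positivity
  have d3 := (Real.hasDerivAt_arcsin (x := √x / √a) (by linarith) lt1.ne).comp x (d1.div_const (√a))
  have e1 : √(1 - (√x / √a)^2) = √(a-x) / √a := by
    rw [div_pow, es, er, ← Real.sqrt_div (by linarith)]
    congr 1; field_simp
  rw [e1] at d3
  have d4 : HasDerivAt (fun y : ℝ => -(3/4)*a - y/2 + 2*p) (-(1/2)) x := by
    have := (((hasDerivAt_id x).div_const 2).const_sub (-(3/4)*a)).add_const (2*p)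
    simpa using this
  have d5 := ((d3.const_mul (2 * ((3/8)*a^2 - a*p + p^2))).add ((d1.mul d2).mul d4)).const_mul (√p)
  refine HasDerivAt.congr_deriv (f := F1 a p) d5 ?_
  simp only [Pi.mul_apply]
  generalize √x = s at *
  generalize √(a-x) = t at *
  generalize √a = r at *
  have : a = s^2+t^2 := by linarith
  subst this
  subst es
  field_simp
  ring

lemma F2_deriv (a p x : ℝ) (hx : 0 < x) (hxa : x < a) (hxp : p ≤ x) :
    HasDerivAt (F2 a p) ((x - p)^2 * max (√x) (√p) / √(x*(a - x))) x := by
  rw [max_eq_left (Real.sqrt_le_sqrt hxp), Real.sqrt_mul hx.le]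
  have hs : 0 < √x := Real.sqrt_pos.2 hx
  have ht : 0 < √(a-x) := Real.sqrt_pos.2 (by linarith)
  have et : √(a-x)^2 = a-x := Real.sq_sqrt (by linarith)
  have d2 : HasDerivAt (fun y => √(a-y)) (-1/(2*√(a-x))) x :=
    ((hasDerivAt_id x).const_sub a).sqrt (by simp; linarith)
  have d5 := (((d2.const_mul ((a-p)^2)).sub (((d2.pow 3).const_mul (2*(a-p))).div_const 3)).add
    ((d2.pow 5).div_const 5)).const_mul (-2)
  refine HasDerivAt.congr_deriv (f := F2 a p) d5 ?_
  generalize √x = s at *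
  generalize √(a-x) = t at *
  have : a = x+t^2 := by linarith
  subst this
  field_simp
  norm_num
  ring

/-- The second moment of the energy transfer rate of the Markov jump process of
energy exchanges (`a` is the ball energy, `p` the piston energy). -/
theorem stmt_14 (a p : ℝ) (ha : 0 < a) (hp : 0 < p) :
    (p < a →
      ∫ x in (0:ℝ)..a,
          (x - p)^2 * max (Real.sqrt x) (Real.sqrt p) / Real.sqrt (x*(a - x)) =
        (16/15) * (a - p) ^ ((5:ℝ)/2)
          - (3/4) * p * (a - 2*p) * Real.sqrt (a - p)
          + 2 * Real.sqrt p * ((3/8)*a^2 - a*p + p^2)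
              * Real.arcsin (Real.sqrt (p/a))) ∧
    (a ≤ p →
      ∫ x in (0:ℝ)..a,
          (x - p)^2 * max (Real.sqrt x) (Real.sqrt p) / Real.sqrt (x*(a - x)) =
        Real.pi * Real.sqrt p * ((3/8)*a^2 - a*p + p^2)) := by
  have hr : √a ≠ 0 := (Real.sqrt_pos.2 ha).ne'
  constructor
  · intro h
    obtain ⟨i1, e1⟩ := ftc_aux _ (F1 a p) 0 p hp.le (F1_cont a p)
      (fun x hx => F1_deriv a p x hx.1 (hx.2.trans h) hx.2.le) (fun x _ => by positivity)
    obtain ⟨i2, e2⟩ := ftc_aux _ (F2 a p) p a h.le (F2_cont a p)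
      (fun x hx => F2_deriv a p x (hp.trans hx.1) hx.2 hx.1.le) (fun x _ => by positivity)
    rw [← intervalIntegral.integral_add_adjacent_intervals i1 i2, e1, e2]
    have e5 : (a - p) ^ ((5:ℝ)/2) = √(a-p)^5 := by
      rw [Real.sqrt_eq_rpow, ← Real.rpow_natCast, ← Real.rpow_mul (by linarith)]
      norm_num
    rw [e5, Real.sqrt_div hp.le]
    simp only [F1, F2, sub_self, Real.sqrt_zero, zero_div, Real.arcsin_zero]
    have et : √(a-p)^2 = a-p := Real.sq_sqrt (by linarith)
    have es : √p^2 = p := Real.sq_sqrt hp.le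
    generalize arcsin (√p / √a) = A
    generalize √(a-p) = t at *
    generalize √p = s at *
    have : a = p+t^2 := by linarith
    subst this
    subst es
    ring
  · intro h
    obtain ⟨i1, e1⟩ := ftc_aux _ (F1 a p) 0 a ha.le (F1_cont a p)
      (fun x hx => F1_deriv a p x hx.1 hx.2 (hx.2.le.trans h)) (fun x _ => by positivity)
    rw [e1]
    simp only [F1, sub_self, Real.sqrt_zero, zero_div, Real.arcsin_zero, div_self hr,
      Real.arcsin_one]
    ring
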